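/- The difference operator L expands in terms of the fundamental q-characters: for every f : ℂ → K and u ∈ ℂ, (L f)(u) = −Σ_{i=0}^{N} (−1)^i T^{(i)}_1(u + i/2)·f(u + i). Equivalently, L = Σ_{i=n+2}^{N} (−1)^i M_{T^{(N−i)}_1(·+i/2)} D^i − Σ_{i=0}^{n} (−1)^i M_{T^{(i)}_1(·+i/2)} D^i. -/

import Mathlib

attribute [local instance 10] Classical.propDecidable

noncomputable section

open Finset

variable {K : Type*} [CommRing K]

/-- `Y_a(u)` as a unit of `K`, with `Y_0(u) = 1`, where
`Y_a(u) = Q_a(u - d_a) Q_a(u + d_a)⁻¹`, `d_a = 1/2` for `a < n` and `d_n = 1`. -/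
def Yq (n : ℕ) (Q : ℕ → ℂ → Kˣ) (a : ℕ) (u : ℂ) : Kˣ :=
  if a = 0 then 1
  else Q a (u - (if a = n then 1 else 2⁻¹)) * (Q a (u + (if a = n then 1 else 2⁻¹)))⁻¹

/-- `z_i(u)` for `i = 1,…,2n`, where `i ≤ n` encodes the letter `i` of the alphabet
`J = {1 ≺ ⋯ ≺ n ≺ n̄ ≺ ⋯ ≺ 1̄}`, and `i > n` encodes the letter `\overline{2n+1-i}`. -/
def zq (n : ℕ) (Q : ℕ → ℂ → Kˣ) (i : ℕ) (u : ℂ) : Kˣ :=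
  if i ≤ n then
    Yq n Q i (u + (i : ℂ) / 2) * (Yq n Q (i - 1) (u + ((i : ℂ) + 1) / 2))⁻¹
  else
    Yq n Q (2 * n - i) (u + ((i : ℂ) + 2) / 2) *
      (Yq n Q (2 * n + 1 - i) (u + ((i : ℂ) + 3) / 2))⁻¹

/-- the common value `x_{n+1}(u) = -x_{n+2}(u)
  = Q_n(u+n/2) Q_n(u+(n+4)/2) Q_n(u+(n+2)/2)⁻²`. -/
def xqmid (n : ℕ) (Q : ℕ → ℂ → Kˣ) (u : ℂ) : K :=
  (Q n (u + (n : ℂ) / 2) : K) * (Q n (u + ((n : ℂ) + 4) / 2) : K) *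
    (((Q n (u + ((n : ℂ) + 2) / 2))⁻¹ : Kˣ) : K) ^ 2

/-- `x_i(u)` for `i = 1,…,N = 2n+2`. -/
def xq (n : ℕ) (Q : ℕ → ℂ → Kˣ) (i : ℕ) (u : ℂ) : K :=
  if i ≤ n then zq n Q i u
  else if i = n + 1 then xqmid n Q u
  else if i = n + 2 then -xqmid n Q u
  else zq n Q (i - 2) u

/-- admissibility of a column tableau: whenever `i_k = c` and `i_l = \bar c`
for some `1 ≤ c ≤ n`, one has `n + k - l ≥ c` (letters encoded as in `zq`,
positions `0`-based, which does not change the difference `k - l`). -/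
def AdmQ (n : ℕ) {a : ℕ} (t : Fin a → Fin (2 * n)) : Prop :=
  ∀ k l : Fin a, ((t k : ℕ) + 1 ≤ n) → ((t l : ℕ) + 1 = 2 * n + 1 - ((t k : ℕ) + 1)) →
    (((t k : ℕ) + 1 : ℤ)) ≤ (n : ℤ) + (k : ℕ) - (l : ℕ)

/-- the column tableau sum: `tabSumQ n Q a v = T^{(a)}_1(v)` for `0 ≤ a ≤ n`, i.e.
`T^{(a)}_1(u + 1/2) = ∑ z_{i_1}(u + (a-1)/2) ⋯ z_{i_a}(u - (a-1)/2)` over strictly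
increasing admissible tableaux. -/
def tabSumQ (n : ℕ) (Q : ℕ → ℂ → Kˣ) (a : ℕ) (v : ℂ) : K :=
  ∑ t ∈ univ.filter (fun t : Fin a → Fin (2 * n) => StrictMono t ∧ AdmQ n t),
    ∏ k : Fin a,
      (zq n Q ((t k : ℕ) + 1) (v + ((a : ℂ) - 2 * (((k : ℕ) : ℂ) + 1)) / 2) : K)

/-- `T^{(a)}_1(v)` for all `a ∈ ℤ`: the fundamental `q`-characters for `1 ≤ a ≤ n`,
extended by `T^{(0)}_1 = 1`, `T^{(a)}_1 = 0` for `a < 0`, and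
`T^{(a)}_1(u) + T^{(N-a)}_1(u) = 0`. -/
def T1q (n : ℕ) (Q : ℕ → ℂ → Kˣ) (a : ℤ) (v : ℂ) : K :=
  if a < 0 then 0
  else if a ≤ (n : ℤ) then tabSumQ n Q a.toNat v
  else if a = (n : ℤ) + 1 then 0
  else if a ≤ 2 * (n : ℤ) + 2 then -tabSumQ n Q (2 * (n : ℤ) + 2 - a).toNat v
  else 0

/-- left-to-right composition of a list of difference operators. -/
def opProd (l : List ((ℂ → K) → (ℂ → K))) : (ℂ → K) → (ℂ → K) :=
  l.foldr (· ∘ ·) id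

/-- the operator `L(u) = (M_{x_1(⋅+n)} - D)(M_{x_2(⋅+n-1)} - D) ⋯ (M_{x_N(⋅+n+1-N)} - D)`,
where `D` is the shift `(Df)(u) = f(u+1)` and `M_g` is multiplication by `g`. -/
def Lq (n : ℕ) (Q : ℕ → ℂ → Kˣ) : (ℂ → K) → (ℂ → K) :=
  opProd ((List.range (2 * n + 2)).map fun j =>
    fun f u => xq n Q (j + 1) (u + (n : ℂ) - (j : ℂ)) * f u - f (u + 1))

/-- `ε_i = -1` for `i = n+1, n+2` and `= 1` otherwise. -/
def epsq (n : ℕ) (i : ℕ) : K := if i = n + 1 ∨ i = n + 2 then -1 else 1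

/-- `L_j`, the left-to-right composition over `i = N+1-j, …, N` of the operators
`D - ε_i M_{x_i(⋅+n+1-i)}`. -/
def Ljq (n : ℕ) (Q : ℕ → ℂ → Kˣ) (j : ℕ) : (ℂ → K) → (ℂ → K) :=
  opProd ((List.range j).map fun r =>
    fun f u => f (u + 1) -
      epsq n (2 * n + 3 - j + r) * xq n Q (2 * n + 3 - j + r)
        (u + (n : ℂ) + 1 - ((2 * n + 3 - j + r : ℕ) : ℂ)) * f u)

/-- the Casorati determinant `det_{1 ≤ r,s ≤ j} (w_r(u + s - 1))`
(for a family `w` indexed by `1, 2, …`). -/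
def casq (w : ℕ → ℂ → K) (j : ℕ) (u : ℂ) : K :=
  Matrix.det (Matrix.of fun r s : Fin j => w ((r : ℕ) + 1) (u + ((s : ℕ) : ℂ)))

/-- `ξ^{(a)}_m(u)`: the determinant of the `N × N` matrix whose columns are
`(w_j(u+c))_j` for `c` running over `(0, 1, …, a-1, a+m, a+m+1, …, N+m-1)`. -/
def xiq (n : ℕ) (w : ℕ → ℂ → K) (a m : ℕ) (u : ℂ) : K :=
  Matrix.det (Matrix.of fun j r : Fin (2 * n + 2) =>
    w ((j : ℕ) + 1) (u + ((if (r : ℕ) < a then (r : ℕ) else (r : ℕ) + m : ℕ) : ℂ)))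

/-- the coefficients of the product of the `2r+2` innermost factors of `L`, defined by peeling
off the outermost pair of letters. -/
def innerCoeff (n : ℕ) (Q : ℕ → ℂ → Kˣ) : ℕ → ℤ → ℂ → K
  | 0, m, u => if m = 0 then 1 else if m = 2 then -(xqmid n Q u * xqmid n Q (u - 1)) else 0
  | r + 1, m, u =>
    innerCoeff n Q r m u + (zq n Q (n - r) u : K) * innerCoeff n Q r (m - 1) (u - 1) +
      innerCoeff n Q r (m - 1) u * (zq n Q (n + r + 1) (u - m + 1) : K) +
      (zq n Q (n - r) u : K) * innerCoeff n Q r (m - 2) (u - 1) *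
        (zq n Q (n + r + 1) (u - m + 1) : K)

/-- the factor `Y_{n-r}` governing the reflection `m ↦ 2r+2-m` of `innerCoeff`. -/
def reflFactor (n : ℕ) (Q : ℕ → ℂ → Kˣ) (r : ℕ) (u : ℂ) : Kˣ :=
  Yq n Q (n - r) (u + ((n : ℂ) - r + 2) / 2)

theorem zq_lower (n : ℕ) (Q : ℕ → ℂ → Kˣ) (r : ℕ) (hr : r < n) (u : ℂ) :
    zq n Q (n - r) u = reflFactor n Q r (u - 1) * (reflFactor n Q (r + 1) u)⁻¹ := by
  have h : ((n - r : ℕ) : ℂ) = n - r := by push_cast [hr.le]; ring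
  have e1 : u + ((n : ℂ) - r) / 2 = u - 1 + (n - r + 2) / 2 := by ring
  have e2 : u + ((n : ℂ) - r + 1) / 2 = u + (n - (r + 1 : ℕ) + 2) / 2 := by push_cast; ring
  simp only [zq, reflFactor, Nat.sub_le, if_true, h, Nat.sub_sub, e1, e2]

theorem zq_upper (n : ℕ) (Q : ℕ → ℂ → Kˣ) (r : ℕ) (hr : r < n) (u : ℂ) :
    zq n Q (n + r + 1) (u - (r + 1)) =
      reflFactor n Q (r + 1) u * (reflFactor n Q r u)⁻¹ := by
  have h : ¬ (n + r + 1 ≤ n) := by omega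
  have h1 : 2 * n - (n + r + 1) = n - (r + 1) := by omega
  have h2 : 2 * n + 1 - (n + r + 1) = n - r := by omega
  have e1 : u - (r + 1) + (((n + r + 1 : ℕ) : ℂ) + 2) / 2 = u + (n - (r + 1 : ℕ) + 2) / 2 := by
    push_cast; ring
  have e2 : u - (r + 1) + (((n + r + 1 : ℕ) : ℂ) + 3) / 2 = u + (n - r + 2) / 2 := by
    push_cast; ring
  simp only [zq, reflFactor, h, if_false, h1, h2, e1, e2]

theorem xqmid_mul_xqmid (n : ℕ) (hn : n ≠ 0) (Q : ℕ → ℂ → Kˣ) (u : ℂ) :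
    xqmid n Q u * xqmid n Q (u - 1) =
      (reflFactor n Q 0 (u - 1) * (reflFactor n Q 0 u)⁻¹ : Kˣ) := by
  have e1 : u - 1 + ((n : ℂ) + 4) / 2 = u + ((n : ℂ) + 2) / 2 := by ring
  have e2 : u - 1 + ((n : ℂ) + 2) / 2 = u + (n : ℂ) / 2 := by ring
  have e3 : u - 1 + ((n : ℂ) - (0 : ℕ) + 2) / 2 - 1 = u - 1 + (n : ℂ) / 2 := by push_cast; ring
  have e4 : u - 1 + ((n : ℂ) - (0 : ℕ) + 2) / 2 + 1 = u + ((n : ℂ) + 2) / 2 := by push_cast; ring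
  have e5 : u + ((n : ℂ) - (0 : ℕ) + 2) / 2 - 1 = u + (n : ℂ) / 2 := by push_cast; ring
  have e6 : u + ((n : ℂ) - (0 : ℕ) + 2) / 2 + 1 = u + ((n : ℂ) + 4) / 2 := by push_cast; ring
  simp only [xqmid, reflFactor, Yq, Nat.sub_zero, hn, if_false, if_true, e1, e2, e3, e4, e5, e6]
  generalize Q n (u + (n : ℂ) / 2) = a
  generalize Q n (u + ((n : ℂ) + 2) / 2) = b
  generalize Q n (u + ((n : ℂ) + 4) / 2) = c
  generalize Q n (u - 1 + (n : ℂ) / 2) = d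
  simp only [mul_inv_rev, inv_inv, Units.val_mul]
  have ha := a.inv_mul
  have hb := b.inv_mul
  linear_combination (c * d * (b⁻¹ : Kˣ) * (a⁻¹ : Kˣ) : K) * (b * (b⁻¹ : Kˣ) * ha + hb)

theorem innerCoeff_eq_zero (n : ℕ) (Q : ℕ → ℂ → Kˣ) (r : ℕ) (m : ℤ)
    (hm : m < 0 ∨ 2 * (r : ℤ) + 2 < m) (u : ℂ) : innerCoeff n Q r m u = 0 := by
  induction r generalizing m u with
  | zero =>
    have h0 : m ≠ 0 := by omega
    have h2 : m ≠ 2 := by omega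
    simp [innerCoeff, h0, h2]
  | succ r ih =>
    push_cast at hm
    simp only [innerCoeff]
    rw [ih m (by omega), ih (m - 1) (by omega), ih (m - 1) (by omega), ih (m - 2) (by omega)]
    ring

theorem innerCoeff_reflection (n : ℕ) (hn : n ≠ 0) (Q : ℕ → ℂ → Kˣ) (r : ℕ) (hr : r ≤ n)
    (j : ℤ) (u : ℂ) :
    innerCoeff n Q r (r + 1 + j) u =
      -((reflFactor n Q r (u - j) * (reflFactor n Q r u)⁻¹ : Kˣ) *
        innerCoeff n Q r (r + 1 - j) (u - j)) := by
  induction r generalizing j u with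
  | zero =>
    rcases lt_trichotomy j 0 with hj | rfl | hj
    · by_cases h : j = -1
      · subst h
        simp only [innerCoeff]
        norm_num
        have := xqmid_mul_xqmid n hn Q (u + 1)
        rw [add_sub_cancel_right] at this
        rw [this]
        norm_cast
        simp
      · rw [innerCoeff_eq_zero _ _ _ _ (by push_cast; omega),
          innerCoeff_eq_zero _ _ _ _ (by push_cast; omega)]
        simp
    · simp [innerCoeff]
    · by_cases h : j = 1
      · subst h
        simp only [innerCoeff]
        norm_num
        rw [xqmid_mul_xqmid n hn Q u]
        push_cast
        rfl
      · rw [innerCoeff_eq_zero _ _ _ _ (by push_cast; omega),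
          innerCoeff_eq_zero _ _ _ _ (by push_cast; omega)]
        simp
  | succ r ih =>
    have ih := fun j u => ih (by omega) j u
    simp only [innerCoeff]
    have i1 := ih (j + 1) u
    have i2 := ih j (u - 1)
    have i3 := ih j u
    have i4 := ih (j - 1) (u - 1)
    have m1 : ((r + 1 : ℕ) : ℤ) + 1 + j = r + 1 + (j + 1) := by push_cast; ring
    have m2 : (r : ℤ) + 1 + (j + 1) - 1 = r + 1 + j := by ring
    have m3 : (r : ℤ) + 1 + (j + 1) - 2 = r + 1 + (j - 1) := by ring
    have m4 : ((r + 1 : ℕ) : ℤ) + 1 - j = r + 1 - (j - 1) := by push_cast; ring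
    have m5 : (r : ℤ) + 1 - (j - 1) - 1 = r + 1 - j := by ring
    have m6 : (r : ℤ) + 1 - (j - 1) - 2 = r + 1 - (j + 1) := by ring
    have u1 : u - (((r : ℤ) + 1 + (j + 1) : ℤ) : ℂ) + 1 = (u - j) - (r + 1) := by
      push_cast; ring
    have u2 : u - j - (((r : ℤ) + 1 - (j - 1) : ℤ) : ℂ) + 1 = u - (r + 1) := by
      push_cast; ring
    have u3 : u - ((j + 1 : ℤ) : ℂ) = u - j - 1 := by push_cast; ring
    have u4 : u - 1 - (j : ℂ) = u - j - 1 := by ring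
    have u5 : u - 1 - ((j - 1 : ℤ) : ℂ) = u - j := by push_cast; ring
    rw [u3] at i1
    rw [u4] at i2
    rw [u5] at i4
    rw [m1, m2, m3, m4, m5, m6, u1, u2, i1, i2, i3, i4]
    simp only [zq_lower n Q r hr, zq_upper n Q r hr, Units.val_mul]
    have c1 := (reflFactor n Q r u).inv_mul
    have c2 := (reflFactor n Q r (u - 1)).inv_mul
    have c3 := (reflFactor n Q r (u - j)).inv_mul
    have c4 := (reflFactor n Q (r + 1) u).inv_mul
    have c5 := (reflFactor n Q (r + 1) (u - j)).inv_mul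
    generalize reflFactor n Q r u = G at *
    generalize reflFactor n Q r (u - 1) = G₁ at *
    generalize reflFactor n Q r (u - j) = Gj at *
    generalize reflFactor n Q r (u - j - 1) = Gj₁ at *
    generalize reflFactor n Q (r + 1) u = H at *
    generalize reflFactor n Q (r + 1) (u - j) = Hj at *
    generalize innerCoeff n Q r (r + 1 - (j + 1)) (u - j - 1) = A₁
    generalize innerCoeff n Q r (r + 1 - j) (u - j - 1) = A₂
    generalize innerCoeff n Q r (r + 1 - j) (u - j) = A₃
    generalize innerCoeff n Q r (r + 1 - (j - 1)) (u - j) = A₄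
    linear_combination A₁ * Gj₁ * (G⁻¹ : Kˣ) * (H * (H⁻¹ : Kˣ) * c5 + c4) +
      A₂ * Gj₁ * (H⁻¹ : Kˣ) * (c5 - c2) + A₃ * (G⁻¹ : Kˣ) * Hj * (c4 - c3) -
      A₄ * (H⁻¹ : Kˣ) * Hj * (G₁ * (G₁⁻¹ : Kˣ) * c3 + c2)

theorem innerCoeff_middle (n : ℕ) (hn : n ≠ 0) (Q : ℕ → ℂ → Kˣ) (r : ℕ) (hr : r ≤ n) (u : ℂ) :
    innerCoeff n Q r (r + 1) u = 0 := by
  cases r with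
  | zero => simp [innerCoeff]
  | succ r =>
    have m1 : ((r + 1 : ℕ) : ℤ) + 1 = r + 1 + 1 := by push_cast; ring
    have m2 : (r : ℤ) + 1 + 1 - 1 = r + 1 := by ring
    have m3 : (r : ℤ) + 1 + 1 - 2 = r + 1 - 1 := by ring
    have u1 : u - (((r : ℤ) + 1 + 1 : ℤ) : ℂ) + 1 = u - (r + 1) := by push_cast; ring
    have z1 := fun v => innerCoeff_middle n hn Q r (by omega) v
    have z2 := innerCoeff_reflection n hn Q r (by omega) 1 u
    simp only [innerCoeff]
    rw [m1, m2, m3, z1, z1, u1, z2, zq_lower n Q r hr, zq_upper n Q r hr]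
    have c4 := (reflFactor n Q (r + 1) u).inv_mul
    push_cast
    linear_combination (reflFactor n Q r (u - 1) : K) * ((reflFactor n Q r u)⁻¹ : Kˣ) *
      innerCoeff n Q r (r + 1 - 1) (u - 1) * c4

theorem opProd_append_singleton {K : Type*} (l : List ((ℂ → K) → (ℂ → K)))
    (F : (ℂ → K) → (ℂ → K)) (f : ℂ → K) : opProd (l ++ [F]) f = opProd l (F f) := by
  induction l with
  | nil => rfl
  | cons G l ih =>
    change G (opProd (l ++ [F]) f) = G (opProd l (F f))
    rw [ih]

theorem opProd_inner (n : ℕ) (Q : ℕ → ℂ → Kˣ) (r : ℕ) (hr : r ≤ n) (f : ℂ → K) (u : ℂ) :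
    opProd ((List.range' (n - r) (2 * r + 2)).map fun j =>
      fun f u => xq n Q (j + 1) (u + (n : ℂ) - (j : ℂ)) * f u - f (u + 1)) f u =
    ∑ i ∈ range (2 * r + 3),
      (-1 : K) ^ i * innerCoeff n Q r (2 * r + 2 - i) (u + r) * f (u + i) := by
  induction r generalizing f u with
  | zero =>
    simp only [opProd, List.range', List.map, List.foldr, Function.comp, sum_range_succ,
      range_zero, sum_empty, innerCoeff, xq]
    norm_num
    have e : u + 1 + (n : ℂ) - (n + 1) = u := by ring
    have e2 : u + (n : ℂ) - (n + 1) = u - 1 := by ring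
    have e3 : u + 1 + (1 : ℂ) = u + 2 := by ring
    rw [e, e2, e3]
    ring
  | succ r ih =>
    have hl : List.range' (n - (r + 1)) (2 * (r + 1) + 2) =
        (n - r - 1) :: (List.range' (n - r) (2 * r + 2) ++ [n + r + 2]) := by
      rw [show 2 * (r + 1) + 2 = (2 * r + 2 + 1) + 1 by ring, List.range'_succ,
        List.range'_concat, show n - (r + 1) + 1 = n - r by omega,
        show n - (r + 1) = n - r - 1 by omega,
        show n - r + 1 * (2 * r + 2) = n + r + 2 by omega]
    rw [hl, List.map_cons, List.map_append, List.map_singleton]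
    change _ * opProd (_ ++ [_]) f u - opProd (_ ++ [_]) f (u + 1) = _
    rw [opProd_append_singleton, ih (by omega), ih (by omega)]
    have x1 : xq n Q (n - r - 1 + 1) (u + n - ((n - r - 1 : ℕ) : ℂ)) =
        (zq n Q (n - r) (u + r + 1) : K) := by
      have h : ((n - r - 1 : ℕ) : ℂ) = n - r - 1 := by
        rw [Nat.sub_sub, Nat.cast_sub hr]; push_cast; ring
      rw [xq, if_pos (by omega), show n - r - 1 + 1 = n - r by omega, h]
      congr 2; ring
    have x2 : ∀ v : ℂ, xq n Q (n + r + 2 + 1) (v + n - ((n + r + 2 : ℕ) : ℂ)) =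
        (zq n Q (n + r + 1) (v - r - 2) : K) := by
      intro v
      rw [xq, if_neg (by omega), if_neg (by omega), if_neg (by omega)]
      congr 2
      push_cast; ring
    rw [x1]
    simp only [x2]
    set C := innerCoeff n Q r with hC
    have hz : ∀ m v, m < 0 ∨ 2 * (r : ℤ) + 2 < m → C m v = 0 :=
      fun m v h => innerCoeff_eq_zero n Q r m h v
    have hterm : ∀ i : ℕ, (-1 : K) ^ i *
        innerCoeff n Q (r + 1) (2 * ((r + 1 : ℕ) : ℤ) + 2 - i) (u + ((r + 1 : ℕ) : ℂ)) *
          f (u + i) =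
        (-1 : K) ^ i * C (2 * r + 4 - i) (u + r + 1) * f (u + i) +
        (-1 : K) ^ i * zq n Q (n - r) (u + r + 1) * C (2 * r + 3 - i) (u + r) * f (u + i) +
        (-1 : K) ^ i * C (2 * r + 3 - i) (u + r + 1) * zq n Q (n + r + 1) (u + i - r - 2) *
          f (u + i) +
        (-1 : K) ^ i * zq n Q (n - r) (u + r + 1) * C (2 * r + 2 - i) (u + r) *
          zq n Q (n + r + 1) (u + i - r - 2) * f (u + i) := by
      intro i
      simp only [innerCoeff, ← hC]
      have a1 : 2 * ((r + 1 : ℕ) : ℤ) + 2 - i = 2 * r + 4 - i := by push_cast; ring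
      have a2 : (2 : ℤ) * r + 4 - i - 1 = 2 * r + 3 - i := by ring
      have a3 : (2 : ℤ) * r + 4 - i - 2 = 2 * r + 2 - i := by ring
      have a4 : u + ((r + 1 : ℕ) : ℂ) = u + r + 1 := by push_cast; ring
      have a5 : u + r + 1 - ((2 * r + 4 - i : ℤ) : ℂ) + 1 = u + i - r - 2 := by push_cast; ring
      have a6 : u + r + 1 - 1 = u + r := by ring
      rw [a1, a2, a3, a4, a5, a6]
      ring
    rw [sum_congr rfl fun i _ => hterm i, sum_add_distrib, sum_add_distrib, sum_add_distrib,
      show 2 * (r + 1) + 3 = 2 * r + 3 + 1 + 1 by ring]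
    have s1 : ∑ i ∈ range (2 * r + 3 + 1 + 1),
        (-1 : K) ^ i * C (2 * r + 4 - i) (u + r + 1) * f (u + i) =
        ∑ i ∈ range (2 * r + 3),
          (-1 : K) ^ i * C (2 * r + 2 - i) (u + r + 1) * f (u + 1 + i + 1) := by
      rw [sum_range_succ', sum_range_succ', hz _ _ (by push_cast; omega),
        hz _ _ (by push_cast; omega)]
      simp only [mul_zero, zero_mul, add_zero]
      refine sum_congr rfl fun i _ => ?_
      have a1 : (2 : ℤ) * r + 4 - ((i + 1 + 1 : ℕ) : ℤ) = 2 * r + 2 - i := by push_cast; ring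
      have a2 : u + ((i + 1 + 1 : ℕ) : ℂ) = u + 1 + i + 1 := by push_cast; ring
      rw [a1, a2]
      ring
    have s2 : ∑ i ∈ range (2 * r + 3 + 1 + 1),
        (-1 : K) ^ i * zq n Q (n - r) (u + r + 1) * C (2 * r + 3 - i) (u + r) * f (u + i) =
        -∑ i ∈ range (2 * r + 3),
          (-1 : K) ^ i * zq n Q (n - r) (u + r + 1) * C (2 * r + 2 - i) (u + r) *
            f (u + i + 1) := by
      rw [sum_range_succ, sum_range_succ', hz _ _ (by push_cast; omega),
        hz _ _ (by push_cast; omega)]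
      simp only [mul_zero, zero_mul, add_zero]
      rw [← sum_neg_distrib]
      refine sum_congr rfl fun i _ => ?_
      have a1 : (2 : ℤ) * r + 3 - ((i + 1 : ℕ) : ℤ) = 2 * r + 2 - i := by push_cast; ring
      have a2 : u + ((i + 1 : ℕ) : ℂ) = u + i + 1 := by push_cast; ring
      rw [a1, a2]
      ring
    have s3 : ∑ i ∈ range (2 * r + 3 + 1 + 1),
        (-1 : K) ^ i * C (2 * r + 3 - i) (u + r + 1) * zq n Q (n + r + 1) (u + i - r - 2) *
          f (u + i) =
        -∑ i ∈ range (2 * r + 3),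
          (-1 : K) ^ i * C (2 * r + 2 - i) (u + r + 1) *
            zq n Q (n + r + 1) (u + 1 + i - r - 2) * f (u + 1 + i) := by
      rw [sum_range_succ, sum_range_succ', hz _ _ (by push_cast; omega),
        hz _ _ (by push_cast; omega)]
      simp only [mul_zero, zero_mul, add_zero]
      rw [← sum_neg_distrib]
      refine sum_congr rfl fun i _ => ?_
      have a1 : (2 : ℤ) * r + 3 - ((i + 1 : ℕ) : ℤ) = 2 * r + 2 - i := by push_cast; ring
      have a2 : u + ((i + 1 : ℕ) : ℂ) = u + 1 + i := by push_cast; ring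
      rw [a1, a2]
      ring
    have s4 : ∑ i ∈ range (2 * r + 3 + 1 + 1),
        (-1 : K) ^ i * zq n Q (n - r) (u + r + 1) * C (2 * r + 2 - i) (u + r) *
          zq n Q (n + r + 1) (u + i - r - 2) * f (u + i) =
        ∑ i ∈ range (2 * r + 3),
          (-1 : K) ^ i * zq n Q (n - r) (u + r + 1) * C (2 * r + 2 - i) (u + r) *
            zq n Q (n + r + 1) (u + i - r - 2) * f (u + i) := by
      rw [sum_range_succ, sum_range_succ, hz _ _ (by push_cast; omega),
        hz _ _ (by push_cast; omega)]
      simp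
    rw [s1, s2, s3, s4, show u + 1 + (r : ℂ) = u + r + 1 by ring, mul_sum, ← sum_neg_distrib,
      ← sum_neg_distrib, ← sum_add_distrib, ← sum_add_distrib, ← sum_add_distrib,
      ← sum_sub_distrib]
    refine sum_congr rfl fun i _ => ?_
    ring

/-- the weight of the column with entries `S` (encoded `0`-based) and top argument `u`. -/
def colWeight (n : ℕ) (Q : ℕ → ℂ → Kˣ) (S : Finset ℕ) (u : ℂ) : K :=
  ∏ s ∈ S, (zq n Q (s + 1) (u - (#{x ∈ S | x < s} : ℂ)) : K)

theorem colWeight_insert_max (n : ℕ) (Q : ℕ → ℂ → Kˣ) (S : Finset ℕ) (b : ℕ)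
    (hb : ∀ s ∈ S, s < b) (u : ℂ) :
    colWeight n Q (insert b S) u =
      colWeight n Q S u * (zq n Q (b + 1) (u - (#S : ℂ)) : K) := by
  have hbS : b ∉ S := fun h => lt_irrefl _ (hb b h)
  rw [colWeight, prod_insert hbS, mul_comm, colWeight]
  congr 1
  · refine prod_congr rfl fun s hs => ?_
    rw [filter_insert, if_neg (by have := hb s hs; omega)]
  · rw [filter_insert, if_neg (lt_irrefl b), filter_true_of_mem hb]

theorem colWeight_insert_min (n : ℕ) (Q : ℕ → ℂ → Kˣ) (S : Finset ℕ) (a : ℕ)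
    (ha : ∀ s ∈ S, a < s) (u : ℂ) :
    colWeight n Q (insert a S) u = (zq n Q (a + 1) u : K) * colWeight n Q S (u - 1) := by
  have haS : a ∉ S := fun h => lt_irrefl _ (ha a h)
  rw [colWeight, prod_insert haS, colWeight]
  congr 1
  · rw [filter_insert, if_neg (lt_irrefl a), filter_false_of_mem]
    · simp
    · intro s hs
      have := ha s hs
      omega
  · refine prod_congr rfl fun s hs => ?_
    rw [filter_insert, if_pos (ha s hs), card_insert_of_notMem (by simp [haS])]
    congr 2
    push_cast; ring

/-- at most `s` entries of `S` lie in each of the nested windows `[n-s, n+s)`, `s ≤ r`. -/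
def NestedAdm (n r : ℕ) (S : Finset ℕ) : Prop :=
  ∀ s ≤ r, #{x ∈ S | n - s ≤ x ∧ x < n + s} ≤ s

theorem nestedAdm_succ (n r : ℕ) (S : Finset ℕ)
    (hS : ∀ x ∈ S, n - (r + 1) ≤ x ∧ x < n + (r + 1)) :
    NestedAdm n (r + 1) S ↔ NestedAdm n r S ∧ #S ≤ r + 1 := by
  have h : #{x ∈ S | n - (r + 1) ≤ x ∧ x < n + (r + 1)} = #S := by
    rw [filter_true_of_mem hS]
  constructor
  · exact fun H => ⟨fun s hs => H s (by omega), h ▸ H (r + 1) le_rfl⟩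
  · rintro ⟨H, hc⟩ s hs
    rcases Nat.le_succ_iff.mp hs with hs | rfl
    · exact H s hs
    · exact h.trans_le hc

theorem nestedAdm_insert (n r : ℕ) (S : Finset ℕ) (a : ℕ) (ha : a < n - r ∨ n + r ≤ a) :
    NestedAdm n r (insert a S) ↔ NestedAdm n r S := by
  refine forall₂_congr fun s hs => ?_
  rw [filter_insert, if_neg (by omega)]

/-- the sum of the column weights over admissible columns of length `m` in the `2r` innermost
letters. -/
def admSum (n : ℕ) (Q : ℕ → ℂ → Kˣ) (r : ℕ) (m : ℤ) (u : ℂ) : K :=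
  ∑ S ∈ (Ico (n - r) (n + r)).powerset,
    if (#S : ℤ) = m ∧ NestedAdm n r S then colWeight n Q S u else 0

theorem admSum_of_lt (n : ℕ) (Q : ℕ → ℂ → Kˣ) (r : ℕ) (m : ℤ) (hm : r < m) (u : ℂ) :
    admSum n Q r m u = 0 := by
  refine sum_eq_zero fun S hS => if_neg ?_
  rintro ⟨hc, hA⟩
  have := hA r le_rfl
  rw [filter_true_of_mem fun x hx => mem_Ico.mp (mem_powerset.mp hS hx)] at this
  omega

theorem admSum_succ (n : ℕ) (Q : ℕ → ℂ → Kˣ) (r : ℕ) (hr : r + 1 ≤ n) (m : ℤ) (hm : m ≤ r + 1)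
    (u : ℂ) :
    admSum n Q (r + 1) m u =
      admSum n Q r m u + (zq n Q (n - r) u : K) * admSum n Q r (m - 1) (u - 1) +
      admSum n Q r (m - 1) u * (zq n Q (n + r + 1) (u - m + 1) : K) +
      (zq n Q (n - r) u : K) * admSum n Q r (m - 2) (u - 1) *
        (zq n Q (n + r + 1) (u - m + 1) : K) := by
  set I := Ico (n - r) (n + r) with hI
  set a := n - r - 1 with ha
  set b := n + r with hb
  have hIco : Ico (n - (r + 1)) (n + (r + 1)) = insert a (insert b I) := by
    ext x; simp only [mem_Ico, mem_insert, hI]; omega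
  have hbI : b ∉ I := by simp [hI, hb]
  have haI : a ∉ insert b I := by simp only [mem_insert, mem_Ico, hI]; omega
  have ha1 : a + 1 = n - r := by omega
  unfold admSum
  rw [hIco, sum_powerset_insert haI, sum_powerset_insert hbI, sum_powerset_insert hbI]
  rw [mul_sum, sum_mul, mul_sum, sum_mul]
  simp only [← sum_add_distrib]
  refine sum_congr rfl fun S hS => ?_
  have hSI : ∀ x ∈ S, n - r ≤ x ∧ x < n + r := fun x hx => mem_Ico.mp (mem_powerset.mp hS hx)
  have hbS : b ∉ S := fun h => hbI (mem_powerset.mp hS h)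
  have haS : a ∉ S := fun h => haI (mem_insert_of_mem (mem_powerset.mp hS h))
  have habS : a ∉ insert b S := by simp only [mem_insert, not_or]; exact ⟨by omega, haS⟩
  have key : ∀ T : Finset ℕ, T ⊆ insert a (insert b S) → (NestedAdm n r T ↔ NestedAdm n r S) →
      (((#T : ℤ) = m ∧ NestedAdm n (r + 1) T) ↔ ((#T : ℤ) = m ∧ NestedAdm n r S)) := by
    intro T hT hTS
    rw [nestedAdm_succ, hTS]
    · constructor
      · tauto
      · exact fun h => ⟨h.1, h.2, by omega⟩
    · intro x hx
      have := hT hx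
      simp only [mem_insert] at this
      rcases this with h | h | h
      · omega
      · omega
      · have := hSI x h; omega
  have kb : NestedAdm n r (insert b S) ↔ NestedAdm n r S :=
    nestedAdm_insert n r S b (by omega)
  have ka : NestedAdm n r (insert a S) ↔ NestedAdm n r S :=
    nestedAdm_insert n r S a (by omega)
  have kab : NestedAdm n r (insert a (insert b S)) ↔ NestedAdm n r S :=
    (nestedAdm_insert n r _ a (by omega)).trans kb
  simp only [key S (by intro x; simp +contextual) Iff.rfl,
    key _ (subset_insert a (insert b S)) kb, key _ (insert_subset_insert a (subset_insert b S)) ka,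
    key _ Subset.rfl kab]
  have cb : (#(insert b S) : ℤ) = #S + 1 := by rw [card_insert_of_notMem hbS]; push_cast; ring
  have ca : (#(insert a S) : ℤ) = #S + 1 := by rw [card_insert_of_notMem haS]; push_cast; ring
  have cab : (#(insert a (insert b S)) : ℤ) = #S + 2 := by
    rw [card_insert_of_notMem habS, card_insert_of_notMem hbS]; push_cast; ring
  have wb : ∀ v, colWeight n Q (insert b S) v = _ :=
    colWeight_insert_max n Q S b (fun s hs => (hSI s hs).2)
  have wa := colWeight_insert_min n Q S a (fun s hs => by have := (hSI s hs).1; omega) u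
  have wab := colWeight_insert_min n Q (insert b S) a (fun s hs => by
    rcases mem_insert.mp hs with h | h
    · omega
    · have := (hSI s h).1; omega) u
  rw [cb, ca, cab, wab, wb, wb, wa, ha1]
  by_cases hA : NestedAdm n r S
  · have i1 : (#S : ℤ) + 1 = m ↔ (#S : ℤ) = m - 1 := by omega
    have i2 : (#S : ℤ) + 2 = m ↔ (#S : ℤ) = m - 2 := by omega
    simp only [hA, and_true, i1, i2]
    have e1 : (#S : ℤ) = m - 1 → u - (#S : ℂ) = u - m + 1 := by
      intro h
      have : (#S : ℂ) = m - 1 := by exact_mod_cast congrArg (Int.cast : ℤ → ℂ) h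
      rw [this]; ring
    have e2 : (#S : ℤ) = m - 2 → u - 1 - (#S : ℂ) = u - m + 1 := by
      intro h
      have : (#S : ℂ) = m - 2 := by exact_mod_cast congrArg (Int.cast : ℤ → ℂ) h
      rw [this]; ring
    by_cases h1 : (#S : ℤ) = m - 1
    · have h0 : (#S : ℤ) ≠ m := by omega
      have h2 : (#S : ℤ) ≠ m - 2 := by omega
      rw [e1 h1]
      simp only [if_neg h0, if_pos h1, if_neg h2]
      ring
    by_cases h2 : (#S : ℤ) = m - 2
    · have h0 : (#S : ℤ) ≠ m := by omega
      rw [e2 h2]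
      simp only [if_neg h0, if_neg h1, if_pos h2]
      ring
    · simp only [if_neg h1, if_neg h2]
      ring
  · simp [hA]

theorem innerCoeff_eq_admSum (n : ℕ) (hn : n ≠ 0) (Q : ℕ → ℂ → Kˣ) (r : ℕ) (hr : r ≤ n)
    (m : ℤ) (hm : m ≤ r + 1) (u : ℂ) : innerCoeff n Q r m u = admSum n Q r m u := by
  induction r generalizing m u with
  | zero =>
    have h : NestedAdm n 0 ∅ := fun s _ => by simp
    by_cases h0 : m = 0
    · simp [innerCoeff, admSum, colWeight, h, h0]
    · have h2 : m ≠ 2 := by push_cast at hm; omega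
      simp [innerCoeff, admSum, h0, h2, Ne.symm h0]
  | succ r ih =>
    push_cast at hm
    rcases hm.lt_or_eq with hm | rfl
    · have ih := fun m hm u => ih (by omega) m hm u
      rw [admSum_succ n Q r hr m (by omega), innerCoeff, ih m (by omega), ih (m - 1) (by omega),
        ih (m - 1) (by omega), ih (m - 2) (by omega)]
    · rw [admSum_of_lt _ _ _ _ (by push_cast; omega)]
      exact_mod_cast innerCoeff_middle n hn Q (r + 1) hr u

theorem card_window (n : ℕ) {a : ℕ} (t : Fin a → Fin (2 * n)) (ht : StrictMono t) (k l : Fin a)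
    (s : ℕ) (hk : (t k : ℕ) = n - s) (hl : (t l : ℕ) + 1 = n + s) :
    #{x ∈ univ.image (fun j => (t j : ℕ)) | n - s ≤ x ∧ x < n + s} = l + 1 - k := by
  have hinj : Function.Injective fun j => (t j : ℕ) := fun i j h => ht.injective (Fin.ext h)
  rw [filter_image, card_image_of_injective _ hinj, ← Fin.card_Icc]
  congr 1
  ext j
  simp only [mem_filter, mem_univ, true_and, mem_Icc, ← ht.le_iff_le, Fin.le_def]
  omega

theorem admQ_iff_nestedAdm (n : ℕ) {a : ℕ} (t : Fin a → Fin (2 * n)) (ht : StrictMono t) :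
    AdmQ n t ↔ NestedAdm n n (univ.image fun j => (t j : ℕ)) := by
  constructor
  · intro h s
    induction s with
    | zero => intro _; simp
    | succ s ih =>
      intro hs
      have ih := ih (by omega)
      set S := univ.image fun j => (t j : ℕ) with hS
      by_cases hboth : n - (s + 1) ∈ S ∧ n + s ∈ S
      · obtain ⟨h1, h2⟩ := hboth
        simp only [hS, mem_image, mem_univ, true_and] at h1 h2
        obtain ⟨k, hk⟩ := h1
        obtain ⟨l, hl⟩ := h2
        rw [card_window n t ht k l (s + 1) hk (by omega)]
        have := h k l (by omega) (by omega)
        omega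
      · have hsub : ∃ y, ({x ∈ S | n - (s + 1) ≤ x ∧ x < n + (s + 1)}) ⊆
            insert y {x ∈ S | n - s ≤ x ∧ x < n + s} := by
          rcases not_and_or.mp hboth with h' | h'
          · refine ⟨n + s, fun x hx => ?_⟩
            simp only [mem_filter, mem_insert] at hx ⊢
            have : x ≠ n - (s + 1) := fun e => h' (e ▸ hx.1)
            by_cases x = n + s
            · left; assumption
            · right; exact ⟨hx.1, by omega⟩
          · refine ⟨n - (s + 1), fun x hx => ?_⟩
            simp only [mem_filter, mem_insert] at hx ⊢
            have : x ≠ n + s := fun e => h' (e ▸ hx.1)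
            by_cases x = n - (s + 1)
            · left; assumption
            · right; exact ⟨hx.1, by omega⟩
        obtain ⟨y, hy⟩ := hsub
        have := (card_le_card hy).trans (card_insert_le _ _)
        omega
  · intro h k l hk hl
    have hle : k ≤ l := by
      rw [← ht.le_iff_le, Fin.le_def]; omega
    have := h (n - t k) (by omega)
    rw [card_window n t ht k l (n - t k) (by omega) (by omega)] at this
    have := Fin.le_def.mp hle
    omega

theorem colWeight_image (n : ℕ) (Q : ℕ → ℂ → Kˣ) {a : ℕ} (t : Fin a → Fin (2 * n))
    (ht : StrictMono t) (u : ℂ) :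
    colWeight n Q (univ.image fun j => (t j : ℕ)) u =
      ∏ k : Fin a, (zq n Q ((t k : ℕ) + 1) (u - (k : ℕ)) : K) := by
  have hinj : Function.Injective fun j => (t j : ℕ) := fun i j h => ht.injective (Fin.ext h)
  rw [colWeight, prod_image hinj.injOn]
  refine prod_congr rfl fun k _ => ?_
  have : #{x ∈ univ.image (fun j => (t j : ℕ)) | x < (t k : ℕ)} = k := by
    rw [filter_image, card_image_of_injective _ hinj, ← Fin.card_Iio k]
    congr 1
    ext j
    simp only [mem_filter, mem_univ, true_and, mem_Iio, ← ht.lt_iff_lt, Fin.lt_def]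
  rw [this]

theorem tabSumQ_eq_admSum (n : ℕ) (Q : ℕ → ℂ → Kˣ) (a : ℕ) (v : ℂ) :
    tabSumQ n Q a v = admSum n Q n a (v + (a : ℂ) / 2 - 1) := by
  rw [tabSumQ, admSum, ← sum_filter]
  have hinj : ∀ t : Fin a → Fin (2 * n), StrictMono t →
      Function.Injective fun j => (t j : ℕ) := fun t ht i j h => ht.injective (Fin.ext h)
  refine sum_bij (fun t _ => univ.image fun j => (t j : ℕ)) ?_ ?_ ?_ ?_
  · intro t ht
    obtain ⟨-, ht, hA⟩ := mem_filter.mp ht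
    refine mem_filter.mpr ⟨?_, ?_, (admQ_iff_nestedAdm n t ht).mp hA⟩
    · refine mem_powerset.mpr fun x hx => ?_
      obtain ⟨j, -, rfl⟩ := mem_image.mp hx
      rw [mem_Ico]
      omega
    · rw [card_image_of_injective _ (hinj t ht), card_univ, Fintype.card_fin]
  · intro t ht t' ht' h
    have ht := (mem_filter.mp ht).2.1
    have ht' := (mem_filter.mp ht').2.1
    refine (ht.range_inj ht').mp ?_
    have h' := congrArg (fun S : Finset ℕ => (S : Set ℕ)) h
    simp only [coe_image, coe_univ, Set.image_univ] at h'
    have e : ∀ s : Fin a → Fin (2 * n),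
        Set.range (fun j => (s j : ℕ)) = Fin.val '' Set.range s := fun s => by
      rw [← Set.range_comp]; rfl
    rw [e, e] at h'
    exact Fin.val_injective.image_injective h'
  · intro S hS
    obtain ⟨hS, hc, hA⟩ := mem_filter.mp hS
    have hc : #S = a := by exact_mod_cast hc
    have hlt : ∀ j, S.orderEmbOfFin hc j < 2 * n := fun j => by
      have := mem_Ico.mp (mem_powerset.mp hS (S.orderEmbOfFin_mem hc j))
      omega
    let t : Fin a → Fin (2 * n) := fun j => ⟨S.orderEmbOfFin hc j, hlt j⟩
    have ht : StrictMono t := fun i j h => by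
      rw [Fin.lt_def]; exact (S.orderEmbOfFin hc).strictMono h
    have him : (univ.image fun j => (t j : ℕ)) = S := S.image_orderEmbOfFin_univ hc
    refine ⟨t, mem_filter.mpr ⟨mem_univ _, ht, ?_⟩, him⟩
    rw [admQ_iff_nestedAdm n t ht, him]
    exact hA
  · intro t ht
    rw [colWeight_image n Q t (mem_filter.mp ht).2.1]
    refine prod_congr rfl fun k _ => ?_
    congr 2
    ring

theorem reflFactor_self (n : ℕ) (Q : ℕ → ℂ → Kˣ) (u : ℂ) : reflFactor n Q n u = 1 := by
  simp [reflFactor, Yq]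

theorem innerCoeff_eq_neg_T1q (n : ℕ) (hn : n ≠ 0) (Q : ℕ → ℂ → Kˣ) (i : ℕ)
    (hi : i ≤ 2 * n + 2) (u : ℂ) :
    innerCoeff n Q n (2 * n + 2 - i) (u + n) = -T1q n Q i (u + (i : ℂ) / 2) := by
  rw [T1q, if_neg (by omega)]
  rcases lt_trichotomy i (n + 1) with h | rfl | h
  · rw [if_pos (by omega), Int.toNat_natCast, tabSumQ_eq_admSum,
      ← innerCoeff_eq_admSum n hn Q n le_rfl _ (by omega)]
    have := innerCoeff_reflection n hn Q n le_rfl (n + 1 - i) (u + n)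
    rw [reflFactor_self, reflFactor_self] at this
    rw [show (2 * n + 2 - i : ℤ) = n + 1 + (n + 1 - i) by ring, this]
    simp only [mul_one, inv_one, Units.val_one, one_mul]
    congr 2
    · ring
    · push_cast; ring
  · rw [if_neg (by push_cast; omega), if_pos (by push_cast; ring),
      show (2 * n + 2 - ((n + 1 : ℕ) : ℤ) : ℤ) = n + 1 by push_cast; ring,
      innerCoeff_middle n hn Q n le_rfl, neg_zero]
  · rw [if_neg (by omega), if_neg (by omega), if_pos (by omega), neg_neg, tabSumQ_eq_admSum,
      ← innerCoeff_eq_admSum n hn Q n le_rfl _ (by omega)]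
    have e : ((2 * (n : ℤ) + 2 - i).toNat : ℤ) = 2 * n + 2 - i := Int.toNat_of_nonneg (by omega)
    have e' : ((2 * (n : ℤ) + 2 - i).toNat : ℂ) = 2 * n + 2 - i := by
      exact_mod_cast congrArg (Int.cast : ℤ → ℂ) e
    rw [e, e']
    congr 1
    ring

theorem T1q_reflection (n : ℕ) (Q : ℕ → ℂ → Kˣ) (i : ℕ) (h1 : n + 2 ≤ i) (h2 : i ≤ 2 * n + 2)
    (v : ℂ) : T1q n Q ((2 * n + 2 - i : ℕ)) v = -T1q n Q i v := by
  rw [T1q, if_neg (by omega), if_pos (by omega), T1q, if_neg (by omega), if_neg (by omega),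
    if_neg (by omega), if_pos (by omega), neg_neg]
  congr 1
  omega

/-- Theorem 2.5: the expansion of `L` in the fundamental q-characters,
`(Lf)(u) = -∑_{i=0}^{N} (-1)^i T^{(i)}_1(u + i/2) f(u + i)`, equivalently
`L = ∑_{i=n+2}^{N} (-1)^i M_{T^{(N-i)}_1(⋅+i/2)} D^i - ∑_{i=0}^{n} (-1)^i M_{T^{(i)}_1(⋅+i/2)} D^i`. -/
theorem statement4 {K : Type*} [CommRing K] (n : ℕ) (hn : 2 ≤ n) (Q : ℕ → ℂ → Kˣ)
    (f : ℂ → K) (u : ℂ) :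
    Lq n Q f u =
      -∑ i ∈ Finset.range (2 * n + 3),
        (-1 : K) ^ i * T1q n Q i (u + (i : ℂ) / 2) * f (u + (i : ℂ)) ∧
    Lq n Q f u =
      (∑ i ∈ Finset.Icc (n + 2) (2 * n + 2),
        (-1 : K) ^ i * T1q n Q ((2 * n + 2 - i : ℕ)) (u + (i : ℂ) / 2) * f (u + (i : ℂ))) -
      ∑ i ∈ Finset.range (n + 1),
        (-1 : K) ^ i * T1q n Q i (u + (i : ℂ) / 2) * f (u + (i : ℂ)) := by
  have hn0 : n ≠ 0 := by omega
  have expansion : Lq n Q f u =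
      -∑ i ∈ Finset.range (2 * n + 3),
        (-1 : K) ^ i * T1q n Q i (u + (i : ℂ) / 2) * f (u + (i : ℂ)) := by
    have h := opProd_inner n Q n le_rfl f u
    rw [Nat.sub_self, ← List.range_eq_range'] at h
    rw [Lq, h, ← sum_neg_distrib]
    refine sum_congr rfl fun i hi => ?_
    rw [innerCoeff_eq_neg_T1q n hn0 Q i (by have := mem_range.mp hi; omega)]
    ring
  refine ⟨expansion, ?_⟩
  have hmid : T1q n Q ((n + 1 : ℕ) : ℤ) (u + ((n + 1 : ℕ) : ℂ) / 2) = 0 := by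
    rw [T1q, if_neg (by omega), if_neg (by push_cast; omega), if_pos (by push_cast; ring)]
  rw [expansion, ← sum_range_add_sum_Ico _ (show n + 2 ≤ 2 * n + 3 by omega), sum_range_succ, hmid,
    show Icc (n + 2) (2 * n + 2) = Ico (n + 2) (2 * n + 3) from rfl]
  have hrefl : ∑ i ∈ Ico (n + 2) (2 * n + 3),
        (-1 : K) ^ i * T1q n Q ((2 * n + 2 - i : ℕ)) (u + (i : ℂ) / 2) * f (u + (i : ℂ)) =
      -∑ i ∈ Ico (n + 2) (2 * n + 3),
        (-1 : K) ^ i * T1q n Q i (u + (i : ℂ) / 2) * f (u + (i : ℂ)) := by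
    rw [← sum_neg_distrib]
    refine sum_congr rfl fun i hi => ?_
    rw [T1q_reflection n Q i (mem_Ico.mp hi).1 (by have := (mem_Ico.mp hi).2; omega)]
    ring
  rw [hrefl]
  ring
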